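/- arXiv:math/0201268 — 2 statements merged into one kernel-verified Lean document; each statement's English description precedes it below -/
import Mathlib

section
/- Let k be a field, s N : ℕ with N ≥ 1, b : Fin s → Fin s → kˣ with (b i j)^N = 1 for all i, j, a : Fin s → Fin s → ℤ, and L : Fin s → Fin s → Prop a relation such that for all i, j with L i j and all m, (b m i)^(1 - a i j) * (b m j) = 1. Then there exist elements g : Fin s → (Fin s → Multiplicative (ZMod N)) of the group (ℤ/N)^s and group homomorphisms χ : Fin s → ((Fin s → Multiplicative (ZMod N)) →* kˣ) such that χ j (g i) = b i j for all i, j, and for all i, j with L i j and every x in (ℤ/N)^s, (χ i x)^(1 - a i j) * (χ j x) = 1. -/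
/-- The homomorphism from the multiplicative cyclic group of order `N` sending the standard generator
to an element `u` with `u ^ N = 1`. -/
noncomputable def zmodPowersHom {G : Type*} [CommGroup G] {N : ℕ} (u : G) (hu : u ^ N = 1) :
    Multiplicative (ZMod N) →* G :=
  AddMonoidHom.toMultiplicativeLeft
    (ZMod.lift N ⟨zmultiplesHom (Additive G) (Additive.ofMul u), by
      simp [← ofMul_pow, hu]⟩)

theorem zmodPowersHom_intCast {G : Type*} [CommGroup G] {N : ℕ} (u : G) (hu : u ^ N = 1) (n : ℤ) :
    zmodPowersHom u hu (Multiplicative.ofAdd (n : ZMod N)) = u ^ n := by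
  simp [zmodPowersHom]

theorem zmodPowersHom_one {G : Type*} [CommGroup G] {N : ℕ} (u : G) (hu : u ^ N = 1) :
    zmodPowersHom u hu (Multiplicative.ofAdd 1) = u := by
  simpa using zmodPowersHom_intCast u hu 1

/-- a linkable braiding matrix whose entries all satisfy
`(b i j)^N = 1` can be realized over the group `(ℤ/N)^s` (written
multiplicatively as `Fin s → Multiplicative (ZMod N)`). -/
theorem stmt7 {k : Type*} [Field k] {s N : ℕ} (hN : 1 ≤ N)
    (b : Fin s → Fin s → kˣ) (hbN : ∀ i j, (b i j) ^ N = 1)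
    (a : Fin s → Fin s → ℤ) (L : Fin s → Fin s → Prop)
    (hL : ∀ i j, L i j → ∀ m, (b m i) ^ (1 - a i j) * b m j = 1) :
    ∃ (g : Fin s → (Fin s → Multiplicative (ZMod N)))
      (χ : Fin s → ((Fin s → Multiplicative (ZMod N)) →* kˣ)),
      (∀ i j, χ j (g i) = b i j) ∧
      (∀ i j, L i j → ∀ x : Fin s → Multiplicative (ZMod N),
        (χ i x) ^ (1 - a i j) * χ j x = 1) := by
  let χ : Fin s → ((Fin s → Multiplicative (ZMod N)) →* kˣ) := fun j ↦
    ∏ m, (zmodPowersHom (b m j) (hbN m j)).comp (Pi.evalMonoidHom _ m)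
  have hχ (j : Fin s) (x : Fin s → Multiplicative (ZMod N)) :
      χ j x = ∏ m, zmodPowersHom (b m j) (hbN m j) (x m) := by
    simp [χ, MonoidHom.finsetProd_apply]
  refine ⟨fun i ↦ Pi.mulSingle i (Multiplicative.ofAdd 1), χ, fun i j ↦ ?_, fun i j hij x ↦ ?_⟩
  · rw [hχ, Finset.prod_eq_single i]
    · simp [zmodPowersHom_one]
    · intro m _ hm
      simp [Pi.mulSingle_eq_of_ne hm]
    · simp
  · rw [hχ, hχ, ← Finset.prod_zpow, ← Finset.prod_mul_distrib]
    refine Finset.prod_eq_one fun m _ ↦ ?_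
    obtain ⟨n, hn⟩ := ZMod.intCast_surjective (x m).toAdd
    rw [← ofAdd_toAdd (x m), ← hn, zmodPowersHom_intCast, zmodPowersHom_intCast, zpow_comm,
      ← mul_zpow, hL i j hij m, one_zpow]
end

section
/- Let n : ℕ with n ≥ 1 and let d : Fin n → ℤ satisfy d t ∈ ({-1, 0, 1} : Set ℤ) for all t, and ∑ t, d t ≤ 0. For a starting index j : Fin n define the clamped walk h_j : ℕ → ℤ recursively by h_j 0 = 0 and h_j (t+1) = max (h_j t + d ((j + t) % n)) 0 (indices taken cyclically modulo n). Then there exists a starting index j : Fin n such that h_j n = 0. -/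
/-- The clamped walk of Lemma 3.5(1): starting at height 0 at vertex `j`,
follow the cycle adding the step `d` of each edge, but never decrease the
height below 0. -/
def clampedWalk {n : ℕ} (d : Fin n → ℤ) (j : Fin n) : ℕ → ℤ
  | 0 => 0
  | t + 1 =>
      max (clampedWalk d j t + d ⟨((j : ℕ) + t) % n, Nat.mod_lt _ j.pos⟩) 0

theorem clampedWalk_nonneg {n : ℕ} (d : Fin n → ℤ) (j : Fin n) (t : ℕ) :
    0 ≤ clampedWalk d j t := by
  cases t with
  | zero => exact le_rfl
  | succ t => exact le_max_right _ _

/-- The sum of the first `m` steps of the cycle, read periodically from vertex `0`. -/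
def cyclicPartialSum {n : ℕ} (hn : 0 < n) (d : Fin n → ℤ) (m : ℕ) : ℤ :=
  ∑ k ∈ Finset.range m, d ⟨k % n, Nat.mod_lt k hn⟩

theorem cyclicPartialSum_self {n : ℕ} (hn : 0 < n) (d : Fin n → ℤ) :
    cyclicPartialSum hn d n = ∑ t, d t := by
  simp [cyclicPartialSum, Finset.sum_range, Nat.mod_eq_of_lt]

theorem cyclicPartialSum_add {n : ℕ} (hn : 0 < n) (d : Fin n → ℤ) (m : ℕ) :
    cyclicPartialSum hn d (n + m) = ∑ t, d t + cyclicPartialSum hn d m := by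
  rw [← cyclicPartialSum_self hn d]
  simp [cyclicPartialSum, Finset.sum_range_add]

/-- The clamped walk at time `t` is the sum of the steps since the last time it was clamped. -/
theorem exists_clampedWalk_eq_sub {n : ℕ} (hn : 0 < n) (d : Fin n → ℤ) (j : Fin n) (t : ℕ) :
    ∃ s ≤ t, clampedWalk d j t =
      cyclicPartialSum hn d (j + t) - cyclicPartialSum hn d (j + s) := by
  induction t with
  | zero => exact ⟨0, le_rfl, by simp [clampedWalk]⟩
  | succ t ih =>
    obtain ⟨s, hs, h⟩ := ih
    rcases le_total (clampedWalk d j t + d ⟨((j : ℕ) + t) % n, Nat.mod_lt _ j.pos⟩) 0 with hc | hc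
    · exact ⟨t + 1, le_rfl, by rw [clampedWalk, max_eq_right hc, sub_self]⟩
    · refine ⟨s, by lia, ?_⟩
      have hstep : cyclicPartialSum hn d (j + (t + 1)) = cyclicPartialSum hn d (j + t) +
          d ⟨((j : ℕ) + t) % n, Nat.mod_lt _ hn⟩ := Finset.sum_range_succ _ _
      rw [clampedWalk, max_eq_left hc, h, hstep]
      ring

/-- Lemma 3.5(1) of the paper: in a cycle of length `n ≥ 1`
with steps `d t ∈ {-1, 0, 1}` summing to at most 0, there is a starting
vertex `j` whose clamped walk around the whole cycle returns to 0
(a Level 0 vertex). -/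
theorem stmt8 (n : ℕ) (hn : 1 ≤ n) (d : Fin n → ℤ)
    (hd : ∀ t, d t ∈ ({-1, 0, 1} : Set ℤ))
    (hsum : ∑ t, d t ≤ 0) :
    ∃ j : Fin n, clampedWalk d j n = 0 := by
  have : Nonempty (Fin n) := ⟨⟨0, hn⟩⟩
  obtain ⟨j, hj⟩ := Finite.exists_min fun i : Fin n => cyclicPartialSum hn d i
  refine ⟨j, le_antisymm ?_ (clampedWalk_nonneg d j n)⟩
  obtain ⟨s, hs, h⟩ := exists_clampedWalk_eq_sub hn d j n
  rw [h, sub_nonpos, add_comm (j : ℕ) n, cyclicPartialSum_add]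
  rcases lt_or_ge ((j : ℕ) + s) n with hlt | hge
  · have := hj ⟨j + s, hlt⟩
    dsimp only at this
    linarith
  · obtain ⟨m, hm⟩ := Nat.exists_eq_add_of_le hge
    have := hj ⟨m, by lia⟩
    dsimp only at this
    rw [hm, cyclicPartialSum_add]
    linarith
end
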